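/- Low-frequency backward estimate, single-mode version (Proposition 3.9 of the paper): there exists a constant C > 0, depending only on q' and F, such that for every m ≥ 1, every λ ≥ 0, and every pair (a, c) solving the mode-λ model system on the interval (0, 1/(2m)], one has for all τ ∈ (0, 1/(2m)]: (τ·a'(τ))² + (1+λ²)·(τ·a(τ))² + ( a(τ) − log(mτ)·τ·a'(τ) )² ≤ C·( a(σ)² + σ²·λ²·a(σ)² + (σ·a'(σ))² + σ²·c(σ)² ), where σ := 1/(2m). The constant C is independent of m, λ, τ, and the solution. -/

import Mathlib

open Set Filter

/-- The pair `(a, c)` solves the mode-`lam` model system on `I ⊆ (0,∞)`: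
`a` is twice differentiable and `c` is differentiable on `I`, and for all `τ ∈ I`,
(E) `a'' + τ⁻¹·a' + 4q'·a + 4λ²·(τ²+1)⁻²·a = f₁·τ·a' + f₂·τ²·a + f₃·c` and
(C) `c' = 2τ·a`. -/
def SolvesModelSystem (q' : ℝ) (f₁ f₂ f₃ : ℝ → ℝ) (lam : ℝ)
    (a c : ℝ → ℝ) (I : Set ℝ) : Prop :=
  ∀ τ ∈ I,
    DifferentiableAt ℝ a τ ∧ DifferentiableAt ℝ (deriv a) τ ∧ DifferentiableAt ℝ c τ ∧
    (deriv (deriv a) τ + τ⁻¹ * deriv a τ + 4 * q' * a τ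
        + 4 * lam ^ 2 * ((τ ^ 2 + 1) ^ 2)⁻¹ * a τ
      = f₁ τ * τ * deriv a τ + f₂ τ * τ ^ 2 * a τ + f₃ τ * c τ) ∧
    deriv c τ = 2 * τ * a τ

/-- The pair `(a, c)` (solving the model system on `(0,∞)`, with `c` extended
continuously to `[0,∞)`) has asymptotic data `(c₀, O, h)` at `τ = 0`. -/
def HasAsymptoticData (a c : ℝ → ℝ) (c₀ O h : ℝ) : Prop :=
  ContinuousOn c (Ici 0) ∧ c 0 = c₀ ∧
  ∃ K : ℝ, 0 ≤ K ∧ ∀ τ ∈ Ioc (0:ℝ) 1,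
    |a τ - O * Real.log τ - h| ≤ K * τ ^ 2 * (1 + Real.log τ ^ 2) ∧
    |deriv a τ - O / τ| ≤ K * τ * (1 + Real.log τ ^ 2)

/-- The total potential `4q' + 4λ²(τ²+1)⁻²` of the mode equation. -/
noncomputable def modePotential (q' lam τ : ℝ) : ℝ :=
  4 * q' + 4 * lam ^ 2 * ((τ ^ 2 + 1) ^ 2)⁻¹

/-- The mode system on `(0, σ]` in first-order form, with `b = τ·a'` and source `R`. -/
structure FirstOrderModeSystem (q' F lam σ : ℝ) (a b c R : ℝ → ℝ) : Prop where
  one_le_q : 1 ≤ q'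
  F_nonneg : 0 ≤ F
  lam_nonneg : 0 ≤ lam
  σ_pos : 0 < σ
  σ_le : σ ≤ 1 / 2
  hasDerivAt_a : ∀ τ ∈ Ioc 0 σ, HasDerivAt a (b τ / τ) τ
  hasDerivAt_b : ∀ τ ∈ Ioc 0 σ, HasDerivAt b (τ * R τ - modePotential q' lam τ * τ * a τ) τ
  hasDerivAt_c : ∀ τ ∈ Ioc 0 σ, HasDerivAt c (2 * τ * a τ) τ
  abs_R_le : ∀ τ ∈ Ioc 0 σ, |R τ| ≤ F * (|b τ| + τ ^ 2 * |a τ| + |c τ|)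

/-- The energy `b² + (4q' + 4λ²(τ²+1)⁻²)τ²a² + τ²c²`. -/
noncomputable def modeEnergy (q' lam : ℝ) (a b c : ℝ → ℝ) (τ : ℝ) : ℝ :=
  b τ ^ 2 + modePotential q' lam τ * τ ^ 2 * a τ ^ 2 + τ ^ 2 * c τ ^ 2

/-- The logarithmic weight `8 + log (σ/τ)`. -/
noncomputable def logWeight (σ τ : ℝ) : ℝ := 8 + (Real.log σ - Real.log τ)

lemma le_of_hasDerivAt_nonneg {f f' : ℝ → ℝ} {s t : ℝ} (hst : s ≤ t)
    (hf : ∀ x ∈ Icc s t, HasDerivAt f (f' x) x) (hf' : ∀ x ∈ Icc s t, 0 ≤ f' x) :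
    f s ≤ f t := by
  refine monotoneOn_of_hasDerivWithinAt_nonneg (convex_Icc s t)
    (fun x hx => (hf x hx).continuousAt.continuousWithinAt)
    (fun x hx => (hf x (interior_subset hx)).hasDerivWithinAt)
    (fun x hx => hf' x (interior_subset hx)) (left_mem_Icc.2 hst) (right_mem_Icc.2 hst) hst

lemma modePotential_ge {q' lam τ : ℝ} (h0 : 0 < τ) (h1 : τ ≤ 1 / 2) :
    4 * q' + lam ^ 2 ≤ modePotential q' lam τ := by
  have hτ : (τ ^ 2 + 1) ^ 2 ≤ 4 := by
    have : τ ^ 2 ≤ 1 := by nlinarith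
    nlinarith [sq_nonneg τ]
  have : 4⁻¹ ≤ ((τ ^ 2 + 1) ^ 2)⁻¹ := inv_anti₀ (by positivity) hτ
  unfold modePotential
  nlinarith [mul_le_mul_of_nonneg_left this (sq_nonneg lam)]

lemma modePotential_le (q' lam τ : ℝ) : modePotential q' lam τ ≤ 4 * q' + 4 * lam ^ 2 := by
  have : ((τ ^ 2 + 1) ^ 2)⁻¹ ≤ 1 := inv_le_one_of_one_le₀ (by nlinarith [sq_nonneg τ])
  unfold modePotential
  nlinarith [mul_le_mul_of_nonneg_left this (sq_nonneg lam)]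

lemma hasDerivAt_modePotential (q' lam τ : ℝ) :
    HasDerivAt (modePotential q' lam) (-(16 * lam ^ 2 * τ * ((τ ^ 2 + 1) ^ 3)⁻¹)) τ := by
  have hne : τ ^ 2 + 1 ≠ 0 := by positivity
  have h := (((((hasDerivAt_id τ).pow 2).add_const 1).pow 2).inv
    (by simpa using hne)).const_mul (4 * lam ^ 2) |>.const_add (4 * q')
  refine h.congr_deriv ?_
  simp
  field_simp
  ring

lemma modePotential_deriv_lower {q' lam τ : ℝ} (hq : 1 ≤ q') (h0 : 0 < τ) (h1 : τ ≤ 1 / 2) :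
    -(4 / 5) * modePotential q' lam τ ≤ τ * -(16 * lam ^ 2 * τ * ((τ ^ 2 + 1) ^ 3)⁻¹) := by
  have hp : 0 < τ ^ 2 + 1 := by positivity
  have hτ : 20 * τ ^ 2 ≤ 4 * (τ ^ 2 + 1) := by nlinarith
  have key : τ ^ 2 * ((τ ^ 2 + 1) ^ 3)⁻¹ ≤ 1 / 5 * ((τ ^ 2 + 1) ^ 2)⁻¹ := by
    rw [← div_eq_mul_inv, ← div_eq_mul_inv, div_le_div_iff₀ (by positivity) (by positivity)]
    have : (0 : ℝ) ≤ (τ ^ 2 + 1) ^ 2 := by positivity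
    nlinarith
  unfold modePotential
  nlinarith [mul_le_mul_of_nonneg_left key (sq_nonneg lam)]

namespace FirstOrderModeSystem

variable {q' F lam σ : ℝ} {a b c R : ℝ → ℝ}

lemma energy_ge (h : FirstOrderModeSystem q' F lam σ a b c R) {τ : ℝ} (hτ : τ ∈ Ioc 0 σ) :
    b τ ^ 2 + (4 * q' + lam ^ 2) * (τ ^ 2 * a τ ^ 2) + τ ^ 2 * c τ ^ 2
      ≤ modeEnergy q' lam a b c τ := by
  have := mul_le_mul_of_nonneg_right
    (modePotential_ge (q' := q') (lam := lam) hτ.1 (hτ.2.trans h.σ_le))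
    (show 0 ≤ τ ^ 2 * a τ ^ 2 by positivity)
  unfold modeEnergy
  linarith

lemma energy_ge_four (h : FirstOrderModeSystem q' F lam σ a b c R) {τ : ℝ}
    (hτ : τ ∈ Ioc 0 σ) :
    b τ ^ 2 + 4 * (τ ^ 2 * a τ ^ 2) + τ ^ 2 * c τ ^ 2 ≤ modeEnergy q' lam a b c τ := by
  have h1 := h.energy_ge hτ
  have h2 : 0 ≤ τ ^ 2 * a τ ^ 2 := by positivity
  nlinarith [h.one_le_q, sq_nonneg lam, mul_nonneg (sq_nonneg lam) h2]

lemma energy_nonneg (h : FirstOrderModeSystem q' F lam σ a b c R) {τ : ℝ}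
    (hτ : τ ∈ Ioc 0 σ) : 0 ≤ modeEnergy q' lam a b c τ :=
  le_trans (by positivity) (h.energy_ge_four hτ)

lemma sq_add_sq_le_energy (h : FirstOrderModeSystem q' F lam σ a b c R) {τ : ℝ}
    (hτ : τ ∈ Ioc 0 σ) (hl : 1 ≤ lam * τ) :
    a τ ^ 2 + b τ ^ 2 ≤ modeEnergy q' lam a b c τ := by
  have h1 := h.energy_ge hτ
  have h2 : 1 * a τ ^ 2 ≤ (lam * τ) ^ 2 * a τ ^ 2 :=
    mul_le_mul_of_nonneg_right (by nlinarith) (sq_nonneg _)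
  have h3 : 0 ≤ τ ^ 2 * c τ ^ 2 := by positivity
  have h4 : 0 ≤ 4 * q' * (τ ^ 2 * a τ ^ 2) := by have := h.one_le_q; positivity
  nlinarith

lemma hasDerivAt_energy (h : FirstOrderModeSystem q' F lam σ a b c R) {τ : ℝ}
    (hτ : τ ∈ Ioc 0 σ) :
    HasDerivAt (modeEnergy q' lam a b c)
      (2 * τ * b τ * R τ + (2 * modePotential q' lam τ
        + τ * -(16 * lam ^ 2 * τ * ((τ ^ 2 + 1) ^ 3)⁻¹)) * τ * a τ ^ 2
        + 2 * τ * c τ ^ 2 + 4 * τ ^ 3 * a τ * c τ) τ := by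
  have hne : τ ≠ 0 := hτ.1.ne'
  have hid := (hasDerivAt_id τ).pow 2
  have hd := (((h.hasDerivAt_b τ hτ).pow 2).add
    (((hasDerivAt_modePotential q' lam τ).mul hid).mul ((h.hasDerivAt_a τ hτ).pow 2))).add
    (hid.mul ((h.hasDerivAt_c τ hτ).pow 2))
  refine hd.congr_deriv ?_
  simp
  field_simp
  ring

lemma abs_le_sqrt_energy (h : FirstOrderModeSystem q' F lam σ a b c R) {τ : ℝ}
    (hτ : τ ∈ Ioc 0 σ) :
    |b τ| ≤ √(modeEnergy q' lam a b c τ) ∧ τ * |a τ| ≤ √(modeEnergy q' lam a b c τ) ∧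
      τ * |c τ| ≤ √(modeEnergy q' lam a b c τ) ∧
      lam * (τ * |a τ|) ≤ √(modeEnergy q' lam a b c τ) := by
  have hG := h.energy_ge hτ
  have hq := h.one_le_q
  have ha : 0 ≤ τ ^ 2 * a τ ^ 2 := by positivity
  have hl : 0 ≤ lam ^ 2 * (τ ^ 2 * a τ ^ 2) := by positivity
  have hc : 0 ≤ τ ^ 2 * c τ ^ 2 := by positivity
  have hb := sq_nonneg (b τ)
  have hqa : 1 * (τ ^ 2 * a τ ^ 2) ≤ q' * (τ ^ 2 * a τ ^ 2) :=
    mul_le_mul_of_nonneg_right hq ha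
  refine ⟨?_, ?_, ?_, ?_⟩ <;> apply Real.le_sqrt_of_sq_le <;>
    simp only [mul_pow, sq_abs] <;> linarith

lemma abs_source_le (h : FirstOrderModeSystem q' F lam σ a b c R) {τ : ℝ}
    (hτ : τ ∈ Ioc 0 σ) : |τ * R τ| ≤ 3 * F * √(modeEnergy q' lam a b c τ) := by
  obtain ⟨hb, ha, hc, -⟩ := h.abs_le_sqrt_energy hτ
  obtain ⟨h0, h1⟩ := hτ
  have h2 : τ ≤ 1 := by linarith [h.σ_le]
  have hF := h.F_nonneg
  rw [abs_mul, abs_of_pos h0]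
  calc τ * |R τ| ≤ τ * (F * (|b τ| + τ ^ 2 * |a τ| + |c τ|)) :=
        mul_le_mul_of_nonneg_left (h.abs_R_le τ ⟨h0, h1⟩) h0.le
    _ = F * (τ * |b τ| + τ ^ 2 * (τ * |a τ|) + τ * |c τ|) := by ring
    _ ≤ F * (1 * |b τ| + 1 * (τ * |a τ|) + τ * |c τ|) := by
        gcongr
        nlinarith
    _ ≤ F * (3 * √(modeEnergy q' lam a b c τ)) := by gcongr; linarith
    _ = _ := by ring

lemma deriv_energy_ge (h : FirstOrderModeSystem q' F lam σ a b c R) {τ : ℝ}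
    (hτ : τ ∈ Ioc 0 σ) :
    6 / 5 * (modePotential q' lam τ * τ * a τ ^ 2) + 2 * τ * c τ ^ 2
        - (6 * F + 2) * modeEnergy q' lam a b c τ
      ≤ 2 * τ * b τ * R τ + (2 * modePotential q' lam τ
        + τ * -(16 * lam ^ 2 * τ * ((τ ^ 2 + 1) ^ 3)⁻¹)) * τ * a τ ^ 2
        + 2 * τ * c τ ^ 2 + 4 * τ ^ 3 * a τ * c τ := by
  have hsq := Real.sq_sqrt (h.energy_nonneg hτ)
  have hG := h.energy_ge_four hτ
  have hs := h.abs_source_le hτ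
  obtain ⟨hb, -, -, -⟩ := h.abs_le_sqrt_energy hτ
  have h2 : τ ≤ 1 / 2 := hτ.2.trans h.σ_le
  have hpot := mul_le_mul_of_nonneg_right
    (modePotential_deriv_lower (lam := lam) h.one_le_q hτ.1 h2)
    (show 0 ≤ τ * a τ ^ 2 by have := hτ.1; positivity)
  have h1 : |b τ * (τ * R τ)| ≤ 3 * F * modeEnergy q' lam a b c τ := by
    rw [abs_mul]
    calc _ ≤ √(modeEnergy q' lam a b c τ) * (3 * F * √(modeEnergy q' lam a b c τ)) := by gcongr
      _ = 3 * F * (√(modeEnergy q' lam a b c τ)) ^ 2 := by ring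
      _ = _ := by rw [hsq]
  have h3 := neg_le_of_abs_le h1
  have h4 : -(2 * modeEnergy q' lam a b c τ) ≤ 4 * τ ^ 3 * a τ * c τ := by
    have e1 : |4 * τ ^ 3 * a τ * c τ| = τ * (4 * ((τ * |a τ|) * (τ * |c τ|))) := by
      rw [abs_mul, abs_mul, abs_of_pos (by have := hτ.1; positivity : 0 < 4 * τ ^ 3)]; ring
    have e2 : τ * (4 * ((τ * |a τ|) * (τ * |c τ|))) ≤ 1 * (4 * ((τ * |a τ|) * (τ * |c τ|))) :=
      mul_le_mul_of_nonneg_right (by linarith) (by have := hτ.1; positivity)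
    have e3 := two_mul_le_add_sq (τ * |a τ|) (τ * |c τ|)
    simp only [mul_pow, sq_abs] at e3
    have e4 : 0 ≤ τ ^ 2 * a τ ^ 2 := by positivity
    apply neg_le_of_abs_le
    rw [e1]
    nlinarith [sq_nonneg (b τ)]
  linarith

lemma energy_le (h : FirstOrderModeSystem q' F lam σ a b c R) {s t : ℝ}
    (hs : 0 < s) (hst : s ≤ t) (ht : t ≤ σ) :
    modeEnergy q' lam a b c s ≤ Real.exp (10 * F + 3) * modeEnergy q' lam a b c t := by
  have hF := h.F_nonneg
  have hmono := le_of_hasDerivAt_nonneg hst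
    (f := fun x => Real.exp ((10 * F + 3) * x) * modeEnergy q' lam a b c x)
    (fun x hx => (((hasDerivAt_id x).const_mul (10 * F + 3)).exp).mul
      (h.hasDerivAt_energy ⟨hs.trans_le hx.1, hx.2.trans ht⟩))
    (fun x hx => by
      have hx' : x ∈ Ioc 0 σ := ⟨hs.trans_le hx.1, hx.2.trans ht⟩
      have h0 := h.deriv_energy_ge hx'
      have hG := h.energy_nonneg hx'
      have hP := modePotential_ge (q' := q') (lam := lam) hx'.1 (hx'.2.trans h.σ_le)
      have hP0 : 0 ≤ modePotential q' lam x := by nlinarith [h.one_le_q, sq_nonneg lam]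
      have hx0 := hx'.1.le
      have h1 : 0 ≤ modePotential q' lam x * x * a x ^ 2 := by positivity
      have h2 : 0 ≤ 2 * x * c x ^ 2 := by positivity
      simp only [id, mul_one]
      rw [mul_assoc, ← mul_add]
      apply mul_nonneg (Real.exp_pos _).le
      nlinarith [mul_nonneg hF hG])
  have h1 : 1 ≤ Real.exp ((10 * F + 3) * s) := Real.one_le_exp (by positivity)
  have h2 : Real.exp ((10 * F + 3) * t) ≤ Real.exp (10 * F + 3) := by
    apply Real.exp_le_exp.2
    nlinarith [h.σ_le]
  have hGs := h.energy_nonneg ⟨hs, hst.trans ht⟩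
  have hGt := h.energy_nonneg ⟨hs.trans_le hst, ht⟩
  calc _ ≤ Real.exp ((10 * F + 3) * s) * modeEnergy q' lam a b c s :=
        le_mul_of_one_le_left hGs h1
    _ ≤ Real.exp ((10 * F + 3) * t) * modeEnergy q' lam a b c t := hmono
    _ ≤ _ := mul_le_mul_of_nonneg_right h2 hGt

lemma logWeight_ge {τ : ℝ} (hτ : τ ∈ Ioc 0 σ) : 8 ≤ logWeight σ τ := by
  have := Real.log_le_log hτ.1 hτ.2
  unfold logWeight
  linarith

lemma hasDerivAt_logWeight {τ : ℝ} (hτ : τ ≠ 0) :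
    HasDerivAt (logWeight σ) (-τ⁻¹) τ :=
  (((Real.hasDerivAt_log hτ).const_sub (Real.log σ)).const_add 8)

/-- In the oscillatory region `λτ ≥ 1` the energy decays towards `τ = 0` fast enough to absorb
the square of the logarithmic weight. -/
lemma logWeight_sq_mul_energy_le (h : FirstOrderModeSystem q' F lam σ a b c R) {s : ℝ}
    (hs : s ∈ Ioc 0 σ) (hl : 1 ≤ lam * s) :
    logWeight σ s ^ 2 * modeEnergy q' lam a b c s
      ≤ 120 * Real.exp (10 * F + 3) * modeEnergy q' lam a b c σ := by
  have hF := h.F_nonneg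
  have hmem : ∀ x ∈ Icc s σ, x ∈ Ioc 0 σ := fun x hx => ⟨hs.1.trans_le hx.1, hx.2⟩
  have hsum : ∀ x ∈ Icc s σ, a x ^ 2 + b x ^ 2 ≤ modeEnergy q' lam a b c x := fun x hx =>
    h.sq_add_sq_le_energy (hmem x hx) (hl.trans (mul_le_mul_of_nonneg_left hx.1 h.lam_nonneg))
  have hmono := le_of_hasDerivAt_nonneg hs.2
    (f := fun x => Real.exp ((10 * F + 3) * x) *
      (logWeight σ x ^ 2 * (modeEnergy q' lam a b c x + 1 / 2 * (a x * b x))))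
    (fun x hx => (((hasDerivAt_id x).const_mul (10 * F + 3)).exp).mul
      (((hasDerivAt_logWeight (hmem x hx).1.ne').pow 2).mul
        ((h.hasDerivAt_energy (hmem x hx)).add
        (((h.hasDerivAt_a x (hmem x hx)).mul (h.hasDerivAt_b x (hmem x hx))).const_mul (1 / 2)))))
    (fun x hx => by
      have hx' := hmem x hx
      have hx0 := hx'.1
      have hD := h.deriv_energy_ge hx'
      have hG := h.energy_nonneg hx'
      have hS := hsum x hx
      have hℓ := logWeight_ge hx'
      have hP := modePotential_ge (q' := q') (lam := lam) hx0 (hx'.2.trans h.σ_le)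
      have hP0 : 0 ≤ modePotential q' lam x := by nlinarith [h.one_le_q, sq_nonneg lam]
      have hR : |a x * (x * R x)| ≤ 3 * F * modeEnergy q' lam a b c x := by
        have hsq := Real.sq_sqrt hG
        rw [abs_mul]
        calc _ ≤ √(modeEnergy q' lam a b c x) * (3 * F * √(modeEnergy q' lam a b c x)) := by
              gcongr
              · exact Real.abs_le_sqrt (by nlinarith [sq_nonneg (b x)])
              · exact h.abs_source_le hx'
          _ = 3 * F * (√(modeEnergy q' lam a b c x)) ^ 2 := by ring
          _ = _ := by rw [hsq]
      have hR' := neg_le_of_abs_le hR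
      have hdef : modeEnergy q' lam a b c x / x
          = b x ^ 2 / x + modePotential q' lam x * x * a x ^ 2 + x * c x ^ 2 := by
        unfold modeEnergy
        field_simp
      have hGx : 0 ≤ modeEnergy q' lam a b c x / x := by positivity
      have h1 : 0 ≤ modePotential q' lam x * x * a x ^ 2 := by positivity
      have h2 : 0 ≤ x * c x ^ 2 := by positivity
      have hbx : b x / x * b x = b x ^ 2 / x := by ring
      simp only [id, mul_one, Nat.cast_ofNat, Nat.add_one_sub_one, pow_one, Pi.pow_apply,
        Pi.add_apply, Pi.mul_apply]
      generalize hDdef : (2 * x * b x * R x + (2 * modePotential q' lam x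
        + x * -(16 * lam ^ 2 * x * ((x ^ 2 + 1) ^ 3)⁻¹)) * x * a x ^ 2
        + 2 * x * c x ^ 2 + 4 * x ^ 3 * a x * c x) = D at hD ⊢
      set G := modeEnergy q' lam a b c x
      set ℓ := logWeight σ x
      have hX' : G / x / 2 - (15 / 2 * F + 2) * G
          ≤ D + 1 / 2 * (b x / x * b x + a x * (x * R x - modePotential q' lam x * x * a x)) := by
        rw [hbx]
        nlinarith
      generalize (D + 1 / 2 * (b x / x * b x + a x * (x * R x - modePotential q' lam x * x * a x)))
        = X' at hX' ⊢
      have hXl : 3 / 4 * G ≤ G + 1 / 2 * (a x * b x) := by nlinarith [sq_nonneg (a x + b x)]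
      have hXu : G + 1 / 2 * (a x * b x) ≤ 5 / 4 * G := by nlinarith [sq_nonneg (a x - b x)]
      generalize (G + 1 / 2 * (a x * b x)) = X at hXl hXu ⊢
      have hXx : X * x⁻¹ ≤ 5 / 4 * (G / x) := by
        calc _ ≤ 5 / 4 * G * x⁻¹ := mul_le_mul_of_nonneg_right hXu (by positivity)
          _ = _ := by ring
      have hKX : (10 * F + 3) * (3 / 4 * G) ≤ (10 * F + 3) * X :=
        mul_le_mul_of_nonneg_left hXl (by positivity)
      have hkey : G / x / 2 ≤ X' + (10 * F + 3) * X := by nlinarith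
      have hfin : 0 ≤ ℓ * (X' + (10 * F + 3) * X) - 2 * (X * x⁻¹) := by
        have := mul_le_mul_of_nonneg_left hkey (by linarith : 0 ≤ ℓ)
        have := mul_le_mul_of_nonneg_right hℓ hGx
        nlinarith
      have := mul_nonneg (mul_nonneg (Real.exp_pos ((10 * F + 3) * x)).le
        (by linarith : 0 ≤ ℓ)) hfin
      calc 0 ≤ _ := this
        _ = _ := by ring)
  have hσ : σ ∈ Icc s σ := right_mem_Icc.2 hs.2
  have hs' : s ∈ Icc s σ := left_mem_Icc.2 hs.2
  have hℓσ : logWeight σ σ = 8 := by simp [logWeight]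
  have hGs := h.energy_nonneg hs
  have hGσ := h.energy_nonneg (hmem σ hσ)
  have h1 : 1 ≤ Real.exp ((10 * F + 3) * s) :=
    Real.one_le_exp (mul_nonneg (by positivity) hs.1.le)
  have h2 : Real.exp ((10 * F + 3) * σ) ≤ Real.exp (10 * F + 3) := by
    apply Real.exp_le_exp.2
    nlinarith [h.σ_le]
  have hXl : 3 / 4 * modeEnergy q' lam a b c s
      ≤ modeEnergy q' lam a b c s + 1 / 2 * (a s * b s) := by
    nlinarith [sq_nonneg (a s + b s), hsum s hs']
  have hXu : modeEnergy q' lam a b c σ + 1 / 2 * (a σ * b σ)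
      ≤ 5 / 4 * modeEnergy q' lam a b c σ := by
    nlinarith [sq_nonneg (a σ - b σ), hsum σ hσ]
  simp only [hℓσ] at hmono
  have h3 : logWeight σ s ^ 2 * (3 / 4 * modeEnergy q' lam a b c s)
      ≤ Real.exp (10 * F + 3) * (8 ^ 2 * (5 / 4 * modeEnergy q' lam a b c σ)) := by
    calc _ ≤ logWeight σ s ^ 2 * (modeEnergy q' lam a b c s + 1 / 2 * (a s * b s)) := by gcongr
      _ ≤ Real.exp ((10 * F + 3) * s) *
          (logWeight σ s ^ 2 * (modeEnergy q' lam a b c s + 1 / 2 * (a s * b s))) :=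
        le_mul_of_one_le_left (mul_nonneg (sq_nonneg _) (by linarith)) h1
      _ ≤ _ := hmono
      _ ≤ Real.exp ((10 * F + 3) * σ) * (8 ^ 2 * (5 / 4 * modeEnergy q' lam a b c σ)) := by gcongr
      _ ≤ _ := by gcongr
  have h4 : 0 ≤ Real.exp (10 * F + 3) * modeEnergy q' lam a b c σ := by positivity
  nlinarith

lemma abs_log_sub_log_le (h : FirstOrderModeSystem q' F lam σ a b c R) {x : ℝ}
    (hx : x ∈ Ioc 0 σ) : |Real.log x - Real.log (2 * σ)| ≤ logWeight σ x := by
  have h1 := Real.log_le_log hx.1 hx.2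
  have h2 : Real.log (2 * σ) = Real.log 2 + Real.log σ :=
    Real.log_mul two_ne_zero h.σ_pos.ne'
  have h3 := Real.log_two_lt_d9
  have h4 := Real.log_two_gt_d9
  rw [abs_le]
  unfold logWeight
  constructor <;> linarith

/-- Propagation of the renormalised unknown `a - log (τ/(2σ))·b` inside `λτ ≤ 1`. -/
lemma renormalized_sq_le (h : FirstOrderModeSystem q' F lam σ a b c R) {s t : ℝ}
    (hs : 0 < s) (hst : s ≤ t) (ht : t ≤ σ) (hl : lam * t ≤ 1) :
    (a s - (Real.log s - Real.log (2 * σ)) * b s) ^ 2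
      ≤ 2 * (a t - (Real.log t - Real.log (2 * σ)) * b t) ^ 2
        + 8 * (3 * F + 4 * q' + 4) ^ 2 * Real.exp (10 * F + 3)
          * (logWeight σ t ^ 2 * modeEnergy q' lam a b c t) := by
  have hF := h.F_nonneg
  have hq := h.one_le_q
  have hlam := h.lam_nonneg
  have hmem : ∀ x ∈ Icc s t, x ∈ Ioc 0 σ := fun x hx => ⟨hs.trans_le hx.1, hx.2.trans ht⟩
  have htm := hmem t (right_mem_Icc.2 hst)
  obtain ⟨S, hS⟩ : ∃ S, S = √(Real.exp (10 * F + 3) * modeEnergy q' lam a b c t) := ⟨_, rfl⟩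
  have hS0 : 0 ≤ S := hS ▸ Real.sqrt_nonneg _
  have hS2 : S ^ 2 = Real.exp (10 * F + 3) * modeEnergy q' lam a b c t := by
    rw [hS, Real.sq_sqrt]
    exact mul_nonneg (Real.exp_pos _).le (h.energy_nonneg htm)
  obtain ⟨M, hM⟩ : ∃ M, M = (3 * F + 4 * q' + 4 * lam) * S := ⟨_, rfl⟩
  have hM0 : 0 ≤ M := by rw [hM]; positivity
  have hderiv : ∀ x ∈ Icc s t, |x * R x - modePotential q' lam x * x * a x| ≤ M := by
    intro x hx
    have hx' := hmem x hx
    have hx0 := hx'.1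
    obtain ⟨-, ha, -, hla⟩ := h.abs_le_sqrt_energy hx'
    have hsrc := h.abs_source_le hx'
    have hGS : √(modeEnergy q' lam a b c x) ≤ S :=
      hS ▸ Real.sqrt_le_sqrt (h.energy_le hx0 hx.2 ht)
    have hPle := modePotential_le q' lam x
    have hP := modePotential_ge (q' := q') (lam := lam) hx0 (hx'.2.trans h.σ_le)
    have hP0 : 0 ≤ modePotential q' lam x := by nlinarith [sq_nonneg lam]
    have h1 : |modePotential q' lam x * x * a x| ≤ (4 * q' + 4 * lam) * S := by
      rw [abs_mul, abs_mul, abs_of_nonneg hP0, abs_of_pos hx0]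
      calc _ = modePotential q' lam x * (x * |a x|) := by ring
        _ ≤ (4 * q' + 4 * lam ^ 2) * (x * |a x|) := by gcongr
        _ = 4 * q' * (x * |a x|) + 4 * lam * (lam * (x * |a x|)) := by ring
        _ ≤ 4 * q' * S + 4 * lam * S := by
            gcongr
            · exact ha.trans hGS
            · exact hla.trans hGS
        _ = _ := by ring
    calc _ ≤ |x * R x| + |modePotential q' lam x * x * a x| := abs_sub _ _
      _ ≤ 3 * F * S + (4 * q' + 4 * lam) * S := by
          refine add_le_add (hsrc.trans ?_) h1
          gcongr
      _ = M := by rw [hM]; ring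
  have hprod : ∀ x ∈ Icc s t, |(Real.log x - Real.log (2 * σ)) *
      (x * R x - modePotential q' lam x * x * a x)| ≤ logWeight σ x * M := fun x hx => by
    rw [abs_mul]
    exact mul_le_mul (h.abs_log_sub_log_le (hmem x hx)) (hderiv x hx) (abs_nonneg _)
      ((abs_nonneg _).trans (h.abs_log_sub_log_le (hmem x hx)))
  have hw : ∀ x ∈ Icc s t, HasDerivAt (fun x => a x - (Real.log x - Real.log (2 * σ)) * b x)
      (-((Real.log x - Real.log (2 * σ)) *
        (x * R x - modePotential q' lam x * x * a x))) x := fun x hx => by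
    have hx' := hmem x hx
    refine ((h.hasDerivAt_a x hx').sub (((Real.hasDerivAt_log hx'.1.ne').sub_const _).mul
      (h.hasDerivAt_b x hx'))).congr_deriv ?_
    ring
  have hΦ : ∀ x ∈ Icc s t, HasDerivAt (fun x => M * (x * (logWeight σ x + 1)))
      (M * logWeight σ x) x := fun x hx => by
    have hx' := hmem x hx
    refine (((hasDerivAt_id x).mul
      ((hasDerivAt_logWeight (σ := σ) hx'.1.ne').add_const 1)).const_mul M).congr_deriv ?_
    simp only [id]
    linear_combination -M * mul_inv_cancel₀ hx'.1.ne'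
  have hup := le_of_hasDerivAt_nonneg hst (fun x hx => (hw x hx).add (hΦ x hx))
    (fun x hx => by linarith [(abs_le.1 (hprod x hx)).2])
  have hdn := le_of_hasDerivAt_nonneg hst (fun x hx => (hΦ x hx).sub (hw x hx))
    (fun x hx => by linarith [(abs_le.1 (hprod x hx)).1])
  simp only [Pi.add_apply, Pi.sub_apply] at hup hdn
  have hℓs := logWeight_ge (hmem s (left_mem_Icc.2 hst))
  have hℓt := logWeight_ge htm
  have hΦs : 0 ≤ M * (s * (logWeight σ s + 1)) :=
    mul_nonneg hM0 (mul_nonneg hs.le (by linarith))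
  have hΦt : M * (t * (logWeight σ t + 1)) ≤ 2 * (3 * F + 4 * q' + 4) * (logWeight σ t * S) := by
    have ht1 : t ≤ 1 := by linarith [h.σ_le]
    have h1 : (3 * F + 4 * q' + 4 * lam) * t ≤ 3 * F + 4 * q' + 4 := by
      nlinarith [mul_le_mul_of_nonneg_left ht1 (by positivity : 0 ≤ 3 * F + 4 * q')]
    calc _ = ((3 * F + 4 * q' + 4 * lam) * t) * (S * (logWeight σ t + 1)) := by rw [hM]; ring
      _ ≤ (3 * F + 4 * q' + 4) * (S * (2 * logWeight σ t)) := by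
          gcongr
          linarith
      _ = _ := by ring
  set wt := a t - (Real.log t - Real.log (2 * σ)) * b t
  set ws := a s - (Real.log s - Real.log (2 * σ)) * b s
  have habs : |ws| ≤ |wt| + 2 * (3 * F + 4 * q' + 4) * (logWeight σ t * S) := by
    rw [abs_le]
    constructor
    · linarith [neg_abs_le wt]
    · linarith [le_abs_self wt]
  have hsq := pow_le_pow_left₀ (abs_nonneg ws) habs 2
  rw [sq_abs] at hsq
  calc ws ^ 2 ≤ _ := hsq
    _ ≤ 2 * (|wt| ^ 2 + (2 * (3 * F + 4 * q' + 4) * (logWeight σ t * S)) ^ 2) := add_sq_le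
    _ = 2 * wt ^ 2 + 8 * (3 * F + 4 * q' + 4) ^ 2 * (logWeight σ t ^ 2 * S ^ 2) := by
        rw [sq_abs]; ring
    _ = _ := by rw [hS2]; ring

lemma renormalized_sq_le_weighted (h : FirstOrderModeSystem q' F lam σ a b c R) {τ : ℝ}
    (hτ : τ ∈ Ioc 0 σ) :
    (a τ - (Real.log τ - Real.log (2 * σ)) * b τ) ^ 2
      ≤ 2 * a τ ^ 2 + 2 * (logWeight σ τ ^ 2 * modeEnergy q' lam a b c τ) := by
  have h1 : (Real.log τ - Real.log (2 * σ)) ^ 2 ≤ logWeight σ τ ^ 2 := by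
    rw [← sq_abs]
    exact pow_le_pow_left₀ (abs_nonneg _) (h.abs_log_sub_log_le hτ) 2
  have h2 : b τ ^ 2 ≤ modeEnergy q' lam a b c τ := by
    have := h.energy_ge_four hτ
    have : 0 ≤ τ ^ 2 * a τ ^ 2 := by positivity
    have : 0 ≤ τ ^ 2 * c τ ^ 2 := by positivity
    linarith
  have h3 := mul_le_mul h1 h2 (sq_nonneg _) (sq_nonneg _)
  nlinarith [sq_nonneg (a τ + (Real.log τ - Real.log (2 * σ)) * b τ)]

/-- The renormalised unknown is controlled by the data at `σ`. -/
lemma renormalized_sq_le_data (h : FirstOrderModeSystem q' F lam σ a b c R) {τ : ℝ}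
    (hτ : τ ∈ Ioc 0 σ) :
    (a τ - (Real.log τ - Real.log (2 * σ)) * b τ) ^ 2
      ≤ 4 * a σ ^ 2 + (8 + 8 * (3 * F + 4 * q' + 4) ^ 2 * Real.exp (10 * F + 3))
        * (120 * Real.exp (10 * F + 3) * modeEnergy q' lam a b c σ) := by
  have hF := h.F_nonneg
  have hσ : σ ∈ Ioc 0 σ := ⟨h.σ_pos, le_rfl⟩
  have hGσ := h.energy_nonneg hσ
  have hosc : ∀ t ∈ Ioc 0 σ, 1 ≤ lam * t →
      (a t - (Real.log t - Real.log (2 * σ)) * b t) ^ 2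
        ≤ 4 * (120 * Real.exp (10 * F + 3) * modeEnergy q' lam a b c σ) := by
    intro t ht hlt
    have h1 := h.renormalized_sq_le_weighted ht
    have h2 := h.logWeight_sq_mul_energy_le ht hlt
    have h3 := h.sq_add_sq_le_energy ht hlt
    have h4 : 1 * modeEnergy q' lam a b c t ≤ logWeight σ t ^ 2 * modeEnergy q' lam a b c t :=
      mul_le_mul_of_nonneg_right (by nlinarith [logWeight_ge ht]) (h.energy_nonneg ht)
    linarith [sq_nonneg (b t)]
  have hB : 0 ≤ 8 * (3 * F + 4 * q' + 4) ^ 2 * Real.exp (10 * F + 3) := by positivity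
  have hE : 0 ≤ 120 * Real.exp (10 * F + 3) * modeEnergy q' lam a b c σ := by positivity
  have hBE := mul_nonneg hB hE
  rcases le_total 1 (lam * τ) with hl | hl
  · nlinarith [hosc τ hτ hl, sq_nonneg (a σ)]
  rcases le_total (lam * σ) 1 with hlσ | hlσ
  · have h1 := h.renormalized_sq_le hτ.1 hτ.2 le_rfl hlσ
    have h2 := h.renormalized_sq_le_weighted hσ
    have h3 : logWeight σ σ ^ 2 * modeEnergy q' lam a b c σ
        ≤ 120 * Real.exp (10 * F + 3) * modeEnergy q' lam a b c σ := by
      have : logWeight σ σ = 8 := by simp [logWeight]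
      rw [this]
      have : 1 ≤ Real.exp (10 * F + 3) := Real.one_le_exp (by positivity)
      nlinarith
    have h4 := mul_le_mul_of_nonneg_left h3 hB
    nlinarith
  · have hlam : 0 < lam := by
      rcases h.lam_nonneg.eq_or_lt with h0 | h0
      · rw [← h0] at hlσ; linarith
      · exact h0
    have hlt : lam * lam⁻¹ = 1 := mul_inv_cancel₀ hlam.ne'
    have ht : lam⁻¹ ∈ Ioc 0 σ := ⟨inv_pos.2 hlam, (inv_le_iff_one_le_mul₀' hlam).2 hlσ⟩
    have hτt : τ ≤ lam⁻¹ := (le_inv_mul_iff₀ hlam).2 hl |>.trans (by simp)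
    have h1 := h.renormalized_sq_le hτ.1 hτt ht.2 hlt.le
    have h2 := hosc _ ht hlt.ge
    have h3 := mul_le_mul_of_nonneg_left (h.logWeight_sq_mul_energy_le ht hlt.ge) hB
    nlinarith [sq_nonneg (a σ)]

end FirstOrderModeSystem

lemma SolvesModelSystem.firstOrder {q' F lam σ : ℝ} {f₁ f₂ f₃ a c : ℝ → ℝ}
    (hq : 1 ≤ q') (hF : 0 ≤ F) (hlam : 0 ≤ lam) (hσ : 0 < σ) (hσ' : σ ≤ 1 / 2)
    (hf₁ : ∀ τ ≥ (0 : ℝ), |f₁ τ| ≤ F) (hf₂ : ∀ τ ≥ (0 : ℝ), |f₂ τ| ≤ F)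
    (hf₃ : ∀ τ ≥ (0 : ℝ), |f₃ τ| ≤ F)
    (h : SolvesModelSystem q' f₁ f₂ f₃ lam a c (Ioc 0 σ)) :
    FirstOrderModeSystem q' F lam σ a (fun τ => τ * deriv a τ) c
      (fun τ => f₁ τ * τ * deriv a τ + f₂ τ * τ ^ 2 * a τ + f₃ τ * c τ) where
  one_le_q := hq
  F_nonneg := hF
  lam_nonneg := hlam
  σ_pos := hσ
  σ_le := hσ'
  hasDerivAt_a τ hτ := by
    have := (h τ hτ).1.hasDerivAt
    rwa [mul_div_cancel_left₀ _ hτ.1.ne']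
  hasDerivAt_b τ hτ := by
    obtain ⟨-, h2, -, hE, -⟩ := h τ hτ
    refine ((hasDerivAt_id τ).mul h2.hasDerivAt).congr_deriv ?_
    have := mul_inv_cancel₀ hτ.1.ne'
    simp only [id, modePotential]
    linear_combination τ * hE - deriv a τ * this
  hasDerivAt_c τ hτ := by
    obtain ⟨-, -, h3, -, hC⟩ := h τ hτ
    exact hC ▸ h3.hasDerivAt
  abs_R_le τ hτ := by
    have hτ0 := hτ.1.le
    calc _ ≤ |f₁ τ * τ * deriv a τ| + |f₂ τ * τ ^ 2 * a τ| + |f₃ τ * c τ| := abs_add_three _ _ _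
      _ = |f₁ τ| * |τ * deriv a τ| + |f₂ τ| * (τ ^ 2 * |a τ|) + |f₃ τ| * |c τ| := by
          simp only [abs_mul, abs_pow, sq_abs]
          ring
      _ ≤ F * |τ * deriv a τ| + F * (τ ^ 2 * |a τ|) + F * |c τ| := by
          gcongr
          exacts [hf₁ τ hτ0, hf₂ τ hτ0, hf₃ τ hτ0]
      _ = _ := by ring

/-- Low-frequency backward estimate (single-mode version of Proposition 3.9
of the paper). -/
theorem lowFrequency_backward_estimate (q' F : ℝ) (hq : 1 ≤ q') (hF : 0 ≤ F) :
    ∃ C > 0, ∀ f₁ f₂ f₃ : ℝ → ℝ,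
      ContinuousOn f₁ (Ici 0) → ContinuousOn f₂ (Ici 0) → ContinuousOn f₃ (Ici 0) →
      (∀ τ ≥ (0:ℝ), |f₁ τ| ≤ F) → (∀ τ ≥ (0:ℝ), |f₂ τ| ≤ F) → (∀ τ ≥ (0:ℝ), |f₃ τ| ≤ F) →
      ∀ m lam : ℝ, 1 ≤ m → 0 ≤ lam →
      ∀ a c : ℝ → ℝ,
      SolvesModelSystem q' f₁ f₂ f₃ lam a c (Ioc 0 (1 / (2 * m))) →
      ∀ τ ∈ Ioc (0:ℝ) (1 / (2 * m)),
        (τ * deriv a τ) ^ 2 + (1 + lam ^ 2) * (τ * a τ) ^ 2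
            + (a τ - Real.log (m * τ) * (τ * deriv a τ)) ^ 2
          ≤ C * (a (1 / (2 * m)) ^ 2 + (1 / (2 * m)) ^ 2 * lam ^ 2 * a (1 / (2 * m)) ^ 2
              + ((1 / (2 * m)) * deriv a (1 / (2 * m))) ^ 2
              + (1 / (2 * m)) ^ 2 * c (1 / (2 * m)) ^ 2) := by
  obtain ⟨E, hEdef⟩ : ∃ E, E = Real.exp (10 * F + 3) := ⟨_, rfl⟩
  have hE : 0 < E := hEdef ▸ Real.exp_pos _
  obtain ⟨B, hBdef⟩ : ∃ B, B = (8 + 8 * (3 * F + 4 * q' + 4) ^ 2 * E) * (120 * E) := ⟨_, rfl⟩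
  have hB : 0 < B := by rw [hBdef]; positivity
  refine ⟨4 + (E + B) * (4 * q' + 4), by positivity, ?_⟩
  intro f₁ f₂ f₃ _ _ _ hf₁ hf₂ hf₃ m lam hm hlam a c hsol τ hτ
  have hm0 : 0 < m := by linarith
  have hlog : Real.log (m * τ) = Real.log τ - Real.log (2 * (1 / (2 * m))) := by
    rw [show 2 * (1 / (2 * m)) = m⁻¹ by field_simp, Real.log_inv,
      Real.log_mul hm0.ne' hτ.1.ne']
    ring
  rw [hlog]
  have hσ : 0 < 1 / (2 * m) := by positivity
  have hσ' : 1 / (2 * m) ≤ 1 / 2 := by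
    apply one_div_le_one_div_of_le <;> linarith
  generalize 1 / (2 * m) = σ at *
  have h := hsol.firstOrder hq hF hlam hσ hσ' hf₁ hf₂ hf₃
  have hσm : σ ∈ Ioc 0 σ := ⟨hσ, le_rfl⟩
  have hren := h.renormalized_sq_le_data hτ
  have hen := h.energy_le hτ.1 hτ.2 le_rfl
  have hge := h.energy_ge hτ
  have hGσ0 := h.energy_nonneg hσm
  simp only [← hEdef] at hren hen
  have hdata : modeEnergy q' lam a (fun τ => τ * deriv a τ) c σ
      ≤ (4 * q' + 4) * (a σ ^ 2 + σ ^ 2 * lam ^ 2 * a σ ^ 2 + (σ * deriv a σ) ^ 2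
        + σ ^ 2 * c σ ^ 2) := by
    have h1 := mul_le_mul_of_nonneg_right (modePotential_le q' lam σ)
      (by positivity : 0 ≤ σ ^ 2 * a σ ^ 2)
    have h2 : q' * (σ ^ 2 * a σ ^ 2) ≤ q' * (1 * a σ ^ 2) := by
      gcongr
      nlinarith
    have h3 : 0 ≤ q' * (σ ^ 2 * lam ^ 2 * a σ ^ 2) := by positivity
    have h4 : 0 ≤ q' * (σ * deriv a σ) ^ 2 := by positivity
    have h5 : 0 ≤ q' * (σ ^ 2 * c σ ^ 2) := by positivity
    have h6 : 0 ≤ (σ * deriv a σ) ^ 2 := by positivity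
    have h7 : 0 ≤ σ ^ 2 * c σ ^ 2 := by positivity
    have h8 := sq_nonneg (a σ)
    unfold modeEnergy
    nlinarith
  generalize modeEnergy q' lam a (fun τ => τ * deriv a τ) c σ = Gσ at *
  generalize modeEnergy q' lam a (fun τ => τ * deriv a τ) c τ = Gτ at *
  have hren' : (a τ - (Real.log τ - Real.log (2 * σ)) * (τ * deriv a τ)) ^ 2
      ≤ 4 * a σ ^ 2 + B * Gσ := by
    rw [hBdef]
    linarith
  have hlow : (τ * deriv a τ) ^ 2 + (1 + lam ^ 2) * (τ * a τ) ^ 2 ≤ Gτ := by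
    have h1 : 0 ≤ τ ^ 2 * c τ ^ 2 := by positivity
    have h2 : 1 * (τ ^ 2 * a τ ^ 2) ≤ q' * (τ ^ 2 * a τ ^ 2) :=
      mul_le_mul_of_nonneg_right hq (by positivity)
    have h3 : 0 ≤ q' * (τ ^ 2 * a τ ^ 2) := by positivity
    nlinarith
  have hmul := mul_le_mul_of_nonneg_left hdata (by positivity : 0 ≤ E + B)
  have hrest : 0 ≤ σ ^ 2 * lam ^ 2 * a σ ^ 2 + (σ * deriv a σ) ^ 2 + σ ^ 2 * c σ ^ 2 := by
    positivity
  linarith
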